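/- Perturbation structural lemma for low-rank approximation (Achlioptas–McSherry): let A, N : Matrix (Fin m) (Fin n) ℝ and Â = A + N, and let Â_k, A_k, N_k be best rank-k approximations of Â, A, N respectively, each with respect to both the spectral norm and the Frobenius norm. Then ‖A − Â_k‖₂ ≤ ‖A − A_k‖₂ + 2·‖N_k‖₂, and ‖A − Â_k‖_F ≤ ‖A − A_k‖_F + ‖N_k‖_F + 2·√(‖N_k‖_F·‖A_k‖_F). -/

import Mathlib

open Matrix

/-- Frobenius norm of a real matrix. -/
noncomputable def frobNorm {m p : ℕ} (M : Matrix (Fin m) (Fin p) ℝ) : ℝ :=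
  Real.sqrt (∑ i, ∑ j, (M i j) ^ 2)

/-- Spectral norm (`ℓ₂ → ℓ₂` operator norm, largest singular value) of a real matrix. -/
noncomputable def specNorm {m n : ℕ} (M : Matrix (Fin m) (Fin n) ℝ) : ℝ :=
  ‖(Matrix.toEuclideanLin M).toContinuousLinearMap‖

section FrobeniusNorm

variable {m n : ℕ}

lemma frobNorm_nonneg (M : Matrix (Fin m) (Fin n) ℝ) : 0 ≤ frobNorm M :=
  Real.sqrt_nonneg _

lemma frobNorm_sq (M : Matrix (Fin m) (Fin n) ℝ) : frobNorm M ^ 2 = (Mᵀ * M).trace := by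
  rw [frobNorm, Real.sq_sqrt (by positivity), Finset.sum_comm]
  simp [trace, mul_apply, sq]

lemma frobNorm_transpose (M : Matrix (Fin m) (Fin n) ℝ) : frobNorm Mᵀ = frobNorm M := by
  simp only [frobNorm, transpose_apply]
  rw [Finset.sum_comm]

section

attribute [local instance] Matrix.frobeniusNormedAddCommGroup

lemma frobNorm_eq_frobenius_norm (M : Matrix (Fin m) (Fin n) ℝ) : frobNorm M = ‖M‖ := by
  simp [frobNorm, frobenius_norm_def, Real.sqrt_eq_rpow]

lemma frobNorm_add_le (X Y : Matrix (Fin m) (Fin n) ℝ) :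
    frobNorm (X + Y) ≤ frobNorm X + frobNorm Y := by
  simpa only [frobNorm_eq_frobenius_norm] using norm_add_le X Y

lemma frobNorm_eq_zero {M : Matrix (Fin m) (Fin n) ℝ} (h : frobNorm M = 0) : M = 0 := by
  rwa [frobNorm_eq_frobenius_norm, norm_eq_zero] at h

end

lemma frobNorm_neg (M : Matrix (Fin m) (Fin n) ℝ) : frobNorm (-M) = frobNorm M := by
  simp [frobNorm]

lemma frobNorm_le_add_frobNorm_add (X Y : Matrix (Fin m) (Fin n) ℝ) :
    frobNorm X ≤ frobNorm (X + Y) + frobNorm Y := by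
  simpa [frobNorm_neg] using frobNorm_add_le (X + Y) (-Y)

lemma frobNorm_add_sq_of_transpose_mul_eq_zero {X Y : Matrix (Fin m) (Fin n) ℝ}
    (h : Xᵀ * Y = 0) : frobNorm (X + Y) ^ 2 = frobNorm X ^ 2 + frobNorm Y ^ 2 := by
  have h' : Yᵀ * X = 0 := by simpa using congrArg transpose h
  simp [frobNorm_sq, Matrix.add_mul, Matrix.mul_add, h, h']

end FrobeniusNorm

section SpectralNorm

variable {m n : ℕ}

lemma specNorm_nonneg (M : Matrix (Fin m) (Fin n) ℝ) : 0 ≤ specNorm M :=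
  norm_nonneg _

lemma specNorm_add_le (X Y : Matrix (Fin m) (Fin n) ℝ) :
    specNorm (X + Y) ≤ specNorm X + specNorm Y := by
  simpa only [specNorm, map_add] using norm_add_le (toEuclideanLin X).toContinuousLinearMap
    (toEuclideanLin Y).toContinuousLinearMap

lemma specNorm_neg (M : Matrix (Fin m) (Fin n) ℝ) : specNorm (-M) = specNorm M := by
  simp only [specNorm, map_neg, norm_neg]

lemma dotProduct_self_eq_norm_sq (v : Fin n → ℝ) : v ⬝ᵥ v = ‖WithLp.toLp 2 v‖ ^ 2 := by
  rw [EuclideanSpace.norm_sq_eq]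
  simp [dotProduct, sq]

lemma mulVec_dotProduct_self_le (M : Matrix (Fin m) (Fin n) ℝ) (v : Fin n → ℝ) :
    (M *ᵥ v) ⬝ᵥ (M *ᵥ v) ≤ specNorm M ^ 2 * (v ⬝ᵥ v) := by
  rw [dotProduct_self_eq_norm_sq, dotProduct_self_eq_norm_sq, ← mul_pow]
  exact pow_le_pow_left₀ (norm_nonneg _)
    ((toEuclideanLin M).toContinuousLinearMap.le_opNorm (WithLp.toLp 2 v)) 2

lemma specNorm_le_of_forall {M : Matrix (Fin m) (Fin n) ℝ} {c : ℝ} (hc : 0 ≤ c)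
    (h : ∀ v, (M *ᵥ v) ⬝ᵥ (M *ᵥ v) ≤ c ^ 2 * (v ⬝ᵥ v)) : specNorm M ≤ c := by
  refine ContinuousLinearMap.opNorm_le_bound _ hc fun v => ?_
  have := h v.ofLp
  rw [dotProduct_self_eq_norm_sq, dotProduct_self_eq_norm_sq, ← mul_pow] at this
  exact le_of_sq_le_sq this (by positivity)

end SpectralNorm

section Rank

lemma Matrix.rank_add_le_add_rank {m n : ℕ} (X Y : Matrix (Fin m) (Fin n) ℝ) :
    (X + Y).rank ≤ X.rank + Y.rank := by
  rw [rank, mulVecLin_add]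
  exact (Submodule.finrank_mono (LinearMap.range_add_le _ _)).trans
    (Submodule.finrank_add_le_finrank_add_finrank _ _)

lemma Matrix.eq_zero_of_rank_le_zero {m n : ℕ} {X : Matrix (Fin m) (Fin n) ℝ}
    (h : X.rank ≤ 0) : X = 0 := by
  rw [Nat.le_zero, rank, Submodule.finrank_eq_zero, LinearMap.range_eq_bot] at h
  refine Matrix.ext_of_mulVec_single fun j => ?_
  rw [zero_mulVec]
  exact LinearMap.congr_fun h _

end Rank

/-- A real matrix is an orthogonal projection if it is symmetric and idempotent. -/
structure IsOrthProj {m : ℕ} (P : Matrix (Fin m) (Fin m) ℝ) : Prop where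
  transpose_eq : Pᵀ = P
  mul_self : P * P = P

lemma exists_isOrthProj_mul_eq {m n : ℕ} (M : Matrix (Fin m) (Fin n) ℝ) :
    ∃ P : Matrix (Fin m) (Fin m) ℝ, IsOrthProj P ∧ P * M = M ∧ P.rank ≤ M.rank := by
  set U := LinearMap.range (toEuclideanLin M)
  set p : EuclideanSpace ℝ (Fin m) →ₗ[ℝ] EuclideanSpace ℝ (Fin m) := U.starProjection.toLinearMap
  obtain ⟨P, hP⟩ : ∃ P : Matrix (Fin m) (Fin m) ℝ, toEuclideanLin P = p :=
    toEuclideanLin.surjective p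
  have hPv (v : Fin m → ℝ) : WithLp.toLp 2 (P *ᵥ v) = U.starProjection (WithLp.toLp 2 v) :=
    congrArg (fun f => f (WithLp.toLp 2 v)) hP
  have hfix (v : Fin n → ℝ) : P *ᵥ (M *ᵥ v) = M *ᵥ v := by
    apply WithLp.toLp_injective 2
    rw [hPv]
    exact Submodule.starProjection_eq_self_iff.mpr ⟨WithLp.toLp 2 v, rfl⟩
  have hrange (v : Fin m → ℝ) : ∃ u, M *ᵥ u = P *ᵥ v := by
    obtain ⟨u, hu⟩ := U.starProjection_apply_mem (WithLp.toLp 2 v)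
    exact ⟨u.ofLp, WithLp.toLp_injective 2 (by rw [hPv, ← hu]; rfl)⟩
  refine ⟨P, ⟨?_, ?_⟩, ?_, ?_⟩
  · ext i j
    have := U.inner_starProjection_left_eq_right (WithLp.toLp 2 (Pi.single i 1))
      (WithLp.toLp 2 (Pi.single j 1))
    rw [← hPv, ← hPv, EuclideanSpace.inner_toLp_toLp, EuclideanSpace.inner_toLp_toLp] at this
    simpa using this
  · refine Matrix.ext_of_mulVec_single fun j => ?_
    obtain ⟨u, hu⟩ := hrange (Pi.single j 1)
    rw [← mulVec_mulVec, ← hu, hfix]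
  · refine Matrix.ext_of_mulVec_single fun j => ?_
    rw [← mulVec_mulVec, hfix]
  · refine Submodule.finrank_mono ?_
    rintro _ ⟨v, rfl⟩
    exact hrange v

namespace IsOrthProj

variable {m n : ℕ} {P : Matrix (Fin m) (Fin m) ℝ}

lemma transpose_mul_sub_eq_zero (hP : IsOrthProj P) (X : Matrix (Fin m) (Fin n) ℝ)
    {Y : Matrix (Fin m) (Fin n) ℝ} (hY : P * Y = Y) : (X - P * X)ᵀ * Y = 0 := by
  conv_lhs => rw [← hY]
  rw [← Matrix.mul_assoc, transpose_sub, transpose_mul, hP.transpose_eq, Matrix.sub_mul,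
    Matrix.mul_assoc, hP.mul_self, sub_self, Matrix.zero_mul]

lemma frobNorm_sub_sq (hP : IsOrthProj P) (X : Matrix (Fin m) (Fin n) ℝ)
    {Y : Matrix (Fin m) (Fin n) ℝ} (hY : P * Y = Y) :
    frobNorm (X - Y) ^ 2 = frobNorm (X - P * X) ^ 2 + frobNorm (P * X - Y) ^ 2 := by
  rw [← frobNorm_add_sq_of_transpose_mul_eq_zero, sub_add_sub_cancel]
  apply hP.transpose_mul_sub_eq_zero
  rw [Matrix.mul_sub, ← Matrix.mul_assoc, hP.mul_self, hY]

lemma frobNorm_sq_eq (hP : IsOrthProj P) (X : Matrix (Fin m) (Fin n) ℝ) :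
    frobNorm X ^ 2 = frobNorm (X - P * X) ^ 2 + frobNorm (P * X) ^ 2 := by
  simpa using hP.frobNorm_sub_sq X (Y := 0) (by simp)

lemma frobNorm_mul_sq (hP : IsOrthProj P) (X : Matrix (Fin m) (Fin n) ℝ) :
    frobNorm (P * X) ^ 2 = (Xᵀ * P * X).trace := by
  rw [frobNorm_sq, transpose_mul, hP.transpose_eq, Matrix.mul_assoc, ← Matrix.mul_assoc P P,
    hP.mul_self, Matrix.mul_assoc]

lemma vecMul_eq (hP : IsOrthProj P) (v : Fin m → ℝ) : v ᵥ* P = P *ᵥ v := by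
  rw [← mulVec_transpose, hP.transpose_eq]

lemma vecMulVec_self {y : Fin m → ℝ} (hy : y ⬝ᵥ y = 1) : IsOrthProj (vecMulVec y y) where
  transpose_eq := transpose_vecMulVec y y
  mul_self := by rw [vecMulVec_mul_vecMulVec, hy, one_smul]

lemma add {Q : Matrix (Fin m) (Fin m) ℝ} (hP : IsOrthProj P) (hQ : IsOrthProj Q)
    (h : P * Q = 0) : IsOrthProj (P + Q) where
  transpose_eq := by rw [transpose_add, hP.transpose_eq, hQ.transpose_eq]
  mul_self := by
    have h' : Q * P = 0 := by
      simpa [hP.transpose_eq, hQ.transpose_eq] using congrArg transpose h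
    simp [Matrix.add_mul, Matrix.mul_add, h, h', hP.mul_self, hQ.mul_self]

lemma sub {Q : Matrix (Fin m) (Fin m) ℝ} (hP : IsOrthProj P) (hQ : IsOrthProj Q)
    (h : P * Q = Q) : IsOrthProj (P - Q) where
  transpose_eq := by rw [transpose_sub, hP.transpose_eq, hQ.transpose_eq]
  mul_self := by
    have h' : Q * P = Q := by
      simpa [hP.transpose_eq, hQ.transpose_eq] using congrArg transpose h
    simp [Matrix.sub_mul, Matrix.mul_sub, h, h', hP.mul_self, hQ.mul_self]

lemma rank_sub_vecMulVec_lt (hP : IsOrthProj P) {w : Fin m → ℝ} (hw : P *ᵥ w = w)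
    (hw1 : w ⬝ᵥ w = 1) : (P - vecMulVec w w).rank < P.rank := by
  have horth (v : Fin m → ℝ) : w ⬝ᵥ ((P - vecMulVec w w) *ᵥ v) = 0 := by
    rw [dotProduct_mulVec, vecMul_sub, hP.vecMul_eq, hw, vecMul_vecMulVec, hw1, one_smul,
      sub_self, zero_dotProduct]
  refine Submodule.finrank_lt_finrank_of_lt (lt_of_le_of_ne ?_ ?_)
  · rintro _ ⟨v, rfl⟩
    refine ⟨(P - vecMulVec w w) *ᵥ v, ?_⟩
    rw [mulVecLin_apply, mulVecLin_apply, mulVec_mulVec, Matrix.mul_sub, hP.mul_self,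
      mul_vecMulVec, hw]
  · intro h
    have hmem : w ∈ LinearMap.range P.mulVecLin := ⟨w, hw⟩
    rw [← h] at hmem
    obtain ⟨v, hv⟩ := hmem
    have := horth v
    rw [mulVecLin_apply] at hv
    rw [hv, hw1] at this
    exact one_ne_zero this

end IsOrthProj

lemma trace_transpose_mul_vecMulVec_mul {m n : ℕ} (X : Matrix (Fin m) (Fin n) ℝ)
    (y : Fin m → ℝ) : (Xᵀ * vecMulVec y y * X).trace = (Xᵀ *ᵥ y) ⬝ᵥ (Xᵀ *ᵥ y) := by
  rw [mul_vecMulVec, vecMulVec_mul, trace_vecMulVec, ← mulVec_transpose]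

/-- `Y` is a best approximation of `X` of rank at most `k` in the Frobenius norm. -/
structure IsBestFrob {m n : ℕ} (k : ℕ) (X Y : Matrix (Fin m) (Fin n) ℝ) : Prop where
  rank_le : Y.rank ≤ k
  frobNorm_le : ∀ D : Matrix (Fin m) (Fin n) ℝ, D.rank ≤ k → frobNorm (X - Y) ≤ frobNorm (X - D)

namespace IsBestFrob

variable {m n k : ℕ} {X Y : Matrix (Fin m) (Fin n) ℝ}

lemma transpose (h : IsBestFrob k X Y) : IsBestFrob k Xᵀ Yᵀ where
  rank_le := by rw [rank_transpose]; exact h.rank_le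
  frobNorm_le D hD := by
    rw [← frobNorm_transpose, ← frobNorm_transpose (Xᵀ - D)]
    simpa using h.frobNorm_le Dᵀ (by rwa [rank_transpose])

lemma eq_proj_mul (h : IsBestFrob k X Y) {P : Matrix (Fin m) (Fin m) ℝ} (hP : IsOrthProj P)
    (hPk : P.rank ≤ k) (hPY : P * Y = Y) : Y = P * X := by
  have h1 := h.frobNorm_le (P * X) ((rank_mul_le_left P X).trans hPk)
  have h2 := hP.frobNorm_sub_sq X hPY
  have h3 := pow_le_pow_left₀ (frobNorm_nonneg _) h1 2
  have h4 : frobNorm (P * X - Y) = 0 := pow_eq_zero_iff two_ne_zero |>.mp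
    (le_antisymm (by linarith) (sq_nonneg _))
  exact (sub_eq_zero.mp (frobNorm_eq_zero h4)).symm

lemma exists_isOrthProj (h : IsBestFrob k X Y) :
    ∃ P : Matrix (Fin m) (Fin m) ℝ, IsOrthProj P ∧ P.rank ≤ k ∧ Y = P * X := by
  obtain ⟨P, hP, hPY, hPr⟩ := exists_isOrthProj_mul_eq Y
  have hPk := hPr.trans h.rank_le
  exact ⟨P, hP, hPk, h.eq_proj_mul hP hPk hPY⟩

lemma frobNorm_sq_eq (h : IsBestFrob k X Y) :
    frobNorm X ^ 2 = frobNorm (X - Y) ^ 2 + frobNorm Y ^ 2 := by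
  obtain ⟨P, hP, -, rfl⟩ := h.exists_isOrthProj
  exact hP.frobNorm_sq_eq X

lemma frobNorm_proj_mul_le (h : IsBestFrob k X Y) {Q : Matrix (Fin m) (Fin m) ℝ}
    (hQ : IsOrthProj Q) (hQk : Q.rank ≤ k) : frobNorm (Q * X) ≤ frobNorm Y := by
  have h1 := h.frobNorm_le (Q * X) ((rank_mul_le_left Q X).trans hQk)
  have h2 := pow_le_pow_left₀ (frobNorm_nonneg _) h1 2
  refine le_of_sq_le_sq ?_ (frobNorm_nonneg _)
  linarith [h.frobNorm_sq_eq, hQ.frobNorm_sq_eq X]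

lemma transpose_mulVec_le_of_unit (h : IsBestFrob k X Y) (hk : 0 < k)
    {P : Matrix (Fin m) (Fin m) ℝ} (hP : IsOrthProj P) (hPk : P.rank ≤ k) (hY : Y = P * X)
    {y : Fin m → ℝ} (hPy : P *ᵥ y = 0) (hy : y ⬝ᵥ y = 1) :
    (Xᵀ *ᵥ y) ⬝ᵥ (Xᵀ *ᵥ y) ≤ specNorm Yᵀ ^ 2 := by
  have hPyy : P * vecMulVec y y = 0 := by rw [mul_vecMulVec, hPy]; simp
  by_cases hP0 : P = 0
  · have h1 := h.frobNorm_proj_mul_le (.vecMulVec_self hy) ((rank_vecMulVec_le y y).trans hk)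
    have h2 := pow_le_pow_left₀ (frobNorm_nonneg _) h1 2
    rw [(IsOrthProj.vecMulVec_self hy).frobNorm_mul_sq, trace_transpose_mul_vecMulVec_mul, hY,
      hP.frobNorm_mul_sq, hP0] at h2
    simp only [Matrix.mul_zero, Matrix.zero_mul, trace_zero] at h2
    exact h2.trans (sq_nonneg _)
  · obtain ⟨w, hw, hw1⟩ : ∃ w, P *ᵥ w = w ∧ w ⬝ᵥ w = 1 := by
      obtain ⟨v, hv⟩ : ∃ v, P *ᵥ v ≠ 0 := by
        by_contra! hz
        exact hP0 (Matrix.ext_of_mulVec_single fun j => by rw [hz, zero_mulVec])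
      have hpos : 0 < (P *ᵥ v) ⬝ᵥ (P *ᵥ v) := by
        rw [dotProduct_self_eq_norm_sq]
        have : WithLp.toLp 2 (P *ᵥ v) ≠ 0 := by simpa using hv
        positivity
      refine ⟨(√((P *ᵥ v) ⬝ᵥ (P *ᵥ v)))⁻¹ • (P *ᵥ v), ?_, ?_⟩
      · rw [mulVec_smul, mulVec_mulVec, hP.mul_self]
      · rw [smul_dotProduct, dotProduct_smul, smul_eq_mul, smul_eq_mul, ← mul_assoc, ← mul_inv,
          Real.mul_self_sqrt hpos.le, inv_mul_cancel₀ hpos.ne']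
    have hwy : w ⬝ᵥ y = 0 := by
      rw [← hw, ← hP.vecMul_eq, ← dotProduct_mulVec, hPy, dotProduct_zero]
    have hQ : IsOrthProj (P - vecMulVec w w + vecMulVec y y) := by
      refine (hP.sub (.vecMulVec_self hw1) ?_).add (.vecMulVec_self hy) ?_
      · rw [mul_vecMulVec, hw]
      · rw [Matrix.sub_mul, hPyy, vecMulVec_mul_vecMulVec, hwy]
        simp
    have hQk : (P - vecMulVec w w + vecMulVec y y).rank ≤ k := by
      have h1 := rank_add_le_add_rank (P - vecMulVec w w) (vecMulVec y y)
      have h2 := rank_vecMulVec_le y y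
      have h3 := hP.rank_sub_vecMulVec_lt hw hw1
      omega
    have h1 := pow_le_pow_left₀ (frobNorm_nonneg _) (h.frobNorm_proj_mul_le hQ hQk) 2
    rw [hQ.frobNorm_mul_sq, Matrix.mul_add, Matrix.mul_sub, Matrix.add_mul, Matrix.sub_mul,
      trace_add, trace_sub, trace_transpose_mul_vecMulVec_mul, trace_transpose_mul_vecMulVec_mul,
      hY, hP.frobNorm_mul_sq] at h1
    have h2 := mulVec_dotProduct_self_le Yᵀ w
    have h3 : Yᵀ *ᵥ w = Xᵀ *ᵥ w := by
      rw [hY, transpose_mul, hP.transpose_eq, ← mulVec_mulVec, hw]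
    rw [h3, hw1, mul_one] at h2
    linarith

lemma transpose_mulVec_le (h : IsBestFrob k X Y) (hk : 0 < k)
    {P : Matrix (Fin m) (Fin m) ℝ} (hP : IsOrthProj P) (hPk : P.rank ≤ k) (hY : Y = P * X)
    {y : Fin m → ℝ} (hPy : P *ᵥ y = 0) :
    (Xᵀ *ᵥ y) ⬝ᵥ (Xᵀ *ᵥ y) ≤ specNorm Yᵀ ^ 2 * (y ⬝ᵥ y) := by
  by_cases hy0 : y = 0
  · simp [hy0]
  have hpos : 0 < y ⬝ᵥ y := by
    rw [dotProduct_self_eq_norm_sq]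
    have : WithLp.toLp 2 y ≠ 0 := by simpa using hy0
    positivity
  have hinv : (√(y ⬝ᵥ y))⁻¹ * (√(y ⬝ᵥ y))⁻¹ = (y ⬝ᵥ y)⁻¹ := by
    rw [← mul_inv, Real.mul_self_sqrt hpos.le]
  have := h.transpose_mulVec_le_of_unit hk hP hPk hY (y := (√(y ⬝ᵥ y))⁻¹ • y)
    (by rw [mulVec_smul, hPy, smul_zero])
    (by rw [smul_dotProduct, dotProduct_smul, smul_eq_mul, smul_eq_mul, ← mul_assoc, hinv,
      inv_mul_cancel₀ hpos.ne'])
  rw [mulVec_smul, smul_dotProduct, dotProduct_smul, smul_eq_mul, smul_eq_mul, ← mul_assoc, hinv,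
    inv_mul_le_iff₀ hpos] at this
  linarith

lemma specNorm_le (h : IsBestFrob k X Y) (hk : 0 < k) : specNorm X ≤ specNorm Y := by
  obtain ⟨P, hP, -, hYP⟩ := h.exists_isOrthProj
  obtain ⟨Q, hQ, hQk, hYQ⟩ := h.transpose.exists_isOrthProj
  have hXQ : Y = X * Q := by
    rw [← transpose_transpose Y, hYQ, transpose_mul, transpose_transpose, hQ.transpose_eq]
  refine specNorm_le_of_forall (specNorm_nonneg Y) fun v => ?_
  have hQv : Q *ᵥ (v - Q *ᵥ v) = 0 := by
    rw [mulVec_sub, mulVec_mulVec, hQ.mul_self, sub_self]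
  have hYv : Y *ᵥ (Q *ᵥ v) = Y *ᵥ v := by rw [hXQ, mulVec_mulVec, Matrix.mul_assoc, hQ.mul_self]
  have hXv : X *ᵥ (v - Q *ᵥ v) = X *ᵥ v - Y *ᵥ v := by rw [mulVec_sub, mulVec_mulVec, ← hXQ]
  have h1 := h.transpose.transpose_mulVec_le hk hQ hQk hYQ hQv
  have h2 := mulVec_dotProduct_self_le Y (Q *ᵥ v)
  rw [transpose_transpose, transpose_transpose, hXv] at h1
  rw [hYv] at h2
  have h3 : (Y *ᵥ v) ⬝ᵥ (X *ᵥ v) = (Y *ᵥ v) ⬝ᵥ (Y *ᵥ v) := by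
    have hPY : P *ᵥ (Y *ᵥ v) = Y *ᵥ v := by
      rw [mulVec_mulVec, hYP, ← Matrix.mul_assoc, hP.mul_self]
    conv_lhs => rw [← hPY, ← hP.vecMul_eq, ← dotProduct_mulVec, mulVec_mulVec, ← hYP]
  have h4 : (Q *ᵥ v) ⬝ᵥ v = (Q *ᵥ v) ⬝ᵥ (Q *ᵥ v) := by
    conv_rhs => rw [dotProduct_mulVec, hQ.vecMul_eq, mulVec_mulVec, hQ.mul_self]
  simp only [sub_dotProduct, dotProduct_sub, dotProduct_comm (X *ᵥ v) (Y *ᵥ v),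
    dotProduct_comm v (Q *ᵥ v), h3, h4] at h1
  linarith

end IsBestFrob

lemma specNorm_sub_le_of_isBestFrob {m n k : ℕ} {A N Ahatk Ak Nk : Matrix (Fin m) (Fin n) ℝ}
    (hAhatk_rank : Ahatk.rank ≤ k)
    (hAhatk : specNorm (A + N - Ahatk) ≤ specNorm (A + N - Ak))
    (hAk_rank : Ak.rank ≤ k) (hN : IsBestFrob k N Nk) :
    specNorm (A - Ahatk) ≤ specNorm (A - Ak) + 2 * specNorm Nk := by
  rcases Nat.eq_zero_or_pos k with rfl | hk
  · rw [eq_zero_of_rank_le_zero hAhatk_rank, eq_zero_of_rank_le_zero hAk_rank]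
    linarith [specNorm_nonneg Nk]
  · have h1 := specNorm_add_le (A + N - Ahatk) (-N)
    have h2 := specNorm_add_le (A - Ak) N
    rw [specNorm_neg, show A + N - Ahatk + -N = A - Ahatk by abel] at h1
    rw [show A - Ak + N = A + N - Ak by abel] at h2
    linarith [hN.specNorm_le hk]

lemma frobNorm_sub_le_of_isBestFrob {m n k : ℕ} {A N Ahatk Ak Nk : Matrix (Fin m) (Fin n) ℝ}
    (hAhat : IsBestFrob k (A + N) Ahatk) (hA : IsBestFrob k A Ak) (hN : IsBestFrob k N Nk) :
    frobNorm (A - Ahatk) ≤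
      frobNorm (A - Ak) + frobNorm Nk + 2 * √(frobNorm Nk * frobNorm Ak) := by
  obtain ⟨P, hP, hPk, hPA⟩ := hAhat.exists_isOrthProj
  obtain ⟨Q, hQ, hQk, hQA⟩ := hA.exists_isOrthProj
  have hPN := hN.frobNorm_proj_mul_le hP hPk
  have hQN := hN.frobNorm_proj_mul_le hQ hQk
  have hQAhat := hAhat.frobNorm_proj_mul_le hQ hQk
  have h1 := frobNorm_le_add_frobNorm_add (Q * A) (Q * N)
  rw [← Matrix.mul_add, ← hQA] at h1
  have h2 := frobNorm_add_le (P * A) (P * N)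
  rw [← Matrix.mul_add, ← hPA] at h2
  have hlow : frobNorm Ak ≤ frobNorm (P * A) + 2 * frobNorm Nk := by linarith
  have ha := frobNorm_nonneg Ak
  have hν := frobNorm_nonneg Nk
  have hp := frobNorm_nonneg (P * A)
  have hδ := frobNorm_nonneg (A - Ak)
  have hsq : frobNorm Ak ^ 2 ≤ frobNorm (P * A) ^ 2 + 4 * (frobNorm Nk * frobNorm Ak) := by
    by_cases hc : 2 * frobNorm Nk ≤ frobNorm Ak
    · nlinarith
    · nlinarith
  have hres : frobNorm (A - P * A) ≤ frobNorm (A - Ak) + 2 * √(frobNorm Nk * frobNorm Ak) := by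
    refine le_of_sq_le_sq ?_ (by positivity)
    have hs := Real.sq_sqrt (mul_nonneg hν ha)
    have hs0 := mul_nonneg hδ (Real.sqrt_nonneg (frobNorm Nk * frobNorm Ak))
    nlinarith [hA.frobNorm_sq_eq, hP.frobNorm_sq_eq A]
  have h3 := frobNorm_add_le (A - P * A) (-(P * N))
  rw [frobNorm_neg, show A - P * A + -(P * N) = A - Ahatk by rw [hPA, Matrix.mul_add]; abel] at h3
  linarith

theorem stmt_19 {m n : ℕ} (hm : 0 < m) (hn : 0 < n) (k : ℕ)
    (A N : Matrix (Fin m) (Fin n) ℝ)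
    (Ahatk Ak Nk : Matrix (Fin m) (Fin n) ℝ)
    (hAhatk_rank : Matrix.rank Ahatk ≤ k)
    (hAhatk_spec : ∀ D : Matrix (Fin m) (Fin n) ℝ, Matrix.rank D ≤ k →
      specNorm ((A + N) - Ahatk) ≤ specNorm ((A + N) - D))
    (hAhatk_frob : ∀ D : Matrix (Fin m) (Fin n) ℝ, Matrix.rank D ≤ k →
      frobNorm ((A + N) - Ahatk) ≤ frobNorm ((A + N) - D))
    (hAk_rank : Matrix.rank Ak ≤ k)
    (hAk_spec : ∀ D : Matrix (Fin m) (Fin n) ℝ, Matrix.rank D ≤ k →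
      specNorm (A - Ak) ≤ specNorm (A - D))
    (hAk_frob : ∀ D : Matrix (Fin m) (Fin n) ℝ, Matrix.rank D ≤ k →
      frobNorm (A - Ak) ≤ frobNorm (A - D))
    (hNk_rank : Matrix.rank Nk ≤ k)
    (hNk_spec : ∀ D : Matrix (Fin m) (Fin n) ℝ, Matrix.rank D ≤ k →
      specNorm (N - Nk) ≤ specNorm (N - D))
    (hNk_frob : ∀ D : Matrix (Fin m) (Fin n) ℝ, Matrix.rank D ≤ k →
      frobNorm (N - Nk) ≤ frobNorm (N - D)) :
    specNorm (A - Ahatk) ≤ specNorm (A - Ak) + 2 * specNorm Nk ∧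
    frobNorm (A - Ahatk) ≤ frobNorm (A - Ak) + frobNorm Nk +
      2 * Real.sqrt (frobNorm Nk * frobNorm Ak) := by

  exact ⟨specNorm_sub_le_of_isBestFrob hAhatk_rank (hAhatk_spec Ak hAk_rank) hAk_rank
      ⟨hNk_rank, hNk_frob⟩,
    frobNorm_sub_le_of_isBestFrob ⟨hAhatk_rank, hAhatk_frob⟩ ⟨hAk_rank, hAk_frob⟩
      ⟨hNk_rank, hNk_frob⟩⟩
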